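/- Chaitin's halting probability Ω_U = Σ_{p ∈ dom(U)} 2^{−|p|} for a universal prefix-free machine U is not a computable real number. -/

import Mathlib

def ComputableReal (x : ℝ) : Prop :=
  ∃ f : ℕ → ℚ, Computable f ∧ ∀ k : ℕ, |x - (f k : ℝ)| ≤ (2 : ℝ) ^ (-(k : ℤ))

def ComputableComplex (z : ℂ) : Prop :=
  ComputableReal z.re ∧ ComputableReal z.im

def PrefixFreeSet (S : Set (List Bool)) : Prop :=
  ∀ p ∈ S, ∀ q ∈ S, p <+: q → p = q

structure PrefixFreeMachine where
  U : List Bool →. Unit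
  partrec : Partrec U
  prefixFree : PrefixFreeSet {p | (U p).Dom}

def PrefixFreeMachine.Universal (M : PrefixFreeMachine) : Prop :=
  ∀ N : PrefixFreeMachine, ∃ c : List Bool, ∀ p, (M.U (c ++ p)).Dom ↔ (N.U p).Dom

noncomputable def Omega (M : PrefixFreeMachine) : ℝ :=
  ∑' p : {p : List Bool // (M.U p).Dom}, (2 : ℝ) ^ (-(p.val.length : ℤ))

open Encodable Nat.Partrec

abbrev e0 (q : ℚ) : ℕ := @Encodable.encode ℚ Rat.instEncodable q

theorem e0_eq (q : ℚ) : e0 q = Nat.pair (encode q.num) q.den := rfl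
theorem e2 (n : ℕ) : encode (Int.ofNat n) = 2 * n := by
  rfl
theorem e3 (n : ℕ) : encode (Int.negSucc n) = 2 * n + 1 := by
  rfl
theorem toNat_eq (z : ℤ) : z.toNat = if encode z % 2 = 0 then encode z / 2 else 0 := by
  rcases z with n | n
  · rw [e2]; simp
  · rw [e3]; simp
theorem natAbs_eq (z : ℤ) : z.natAbs = (encode z + 1) / 2 := by
  rcases z with n | n
  · rw [e2]; simp; omega
  · rw [e3]; simp; omega
theorem mem_S (n : ℕ) : n ∈ Set.range e0 ↔ 0 < n.unpair.2 ∧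
   ∀ e < n.unpair.1 + n.unpair.2 + 1, ((n.unpair.1 + 1)/2) % e = 0 → n.unpair.2 % e = 0 → e = 1 := by
  have key : ∀ a d : ℕ, 0 < d → ((∀ e < a + d + 1, ((a + 1)/2) % e = 0 → d % e = 0 → e = 1) ↔ 
     Nat.Coprime ((a+1)/2) d) := by
    intro a d hd
    constructor
    · intro h
      have h1 := Nat.gcd_le_right ((a+1)/2) hd
      exact h (Nat.gcd ((a+1)/2) d) (by omega) (Nat.mod_eq_zero_of_dvd (Nat.gcd_dvd_left _ _)) (Nat.mod_eq_zero_of_dvd (Nat.gcd_dvd_right _ _))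
    · intro h e _ h1 h2
      exact Nat.eq_one_of_dvd_coprimes h (Nat.dvd_of_mod_eq_zero h1) (Nat.dvd_of_mod_eq_zero h2)
  constructor
  · rintro ⟨q, rfl⟩
    rw [e0_eq, Nat.unpair_pair]
    refine ⟨q.pos, (key _ _ q.pos).2 ?_⟩
    rw [← natAbs_eq]; exact q.reduced
  · rintro ⟨h1, h2⟩
    rw [key _ _ h1] at h2
    refine ⟨⟨Denumerable.ofNat ℤ n.unpair.1, n.unpair.2, h1.ne', ?_⟩, ?_⟩
    · rw [natAbs_eq, Denumerable.encode_ofNat]; exact h2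
    · rw [e0_eq]
      show Nat.pair (encode (Denumerable.ofNat ℤ n.unpair.1)) n.unpair.2 = n
      rw [Denumerable.encode_ofNat, Nat.pair_unpair]
theorem ofNat_eq : ∃ (_ : DecidablePred (· ∈ Set.range e0)) (_ : Infinite (Set.range e0)), ∀ n, e0 (Denumerable.ofNat ℚ n) = (Nat.Subtype.ofNat (Set.range e0) n).val := by
  let i1 : DecidablePred (· ∈ Set.range e0) := @decidableRangeEncode ℚ Rat.instEncodable
  have i2 : Infinite (Set.range e0) := Infinite.of_injective _ (Equiv.ofInjective _ encode_injective).injective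
  refine ⟨i1, i2, fun n => ?_⟩
  have h : Denumerable.ofNat ℚ n = (@equivRangeEncode ℚ Rat.instEncodable).symm (Nat.Subtype.ofNat (Set.range e0) n) := rfl
  rw [h]
  exact congrArg Subtype.val ((@equivRangeEncode ℚ Rat.instEncodable).apply_symm_apply _)

theorem primS : PrimrecPred (· ∈ Set.range e0) := by
  have u1 : Primrec (fun n : ℕ => n.unpair.1) := Primrec.fst.comp Primrec.unpair
  have u2 : Primrec (fun n : ℕ => n.unpair.2) := Primrec.snd.comp Primrec.unpair
  have R : PrimrecRel (fun e n : ℕ => ¬ (((n.unpair.1 + 1)/2) % e = 0) ∨ ¬ (n.unpair.2 % e = 0) ∨ e = 1) := by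
    refine PrimrecPred.or (PrimrecPred.not ?_) (PrimrecPred.or (PrimrecPred.not ?_) ?_)
    · exact Primrec.eq.comp (Primrec.nat_mod.comp (Primrec.nat_div.comp (Primrec.succ.comp (u1.comp Primrec.snd)) (Primrec.const 2)) Primrec.fst) (Primrec.const 0)
    · exact Primrec.eq.comp (Primrec.nat_mod.comp (u2.comp Primrec.snd) Primrec.fst) (Primrec.const 0)
    · exact Primrec.eq.comp Primrec.fst (Primrec.const 1)
  have R2 := R.forall_lt.comp (Primrec.succ.comp (Primrec.nat_add.comp u1 u2)) Primrec.id
  refine (PrimrecPred.and (Primrec.nat_lt.comp (Primrec.const 0) u2) R2).of_eq fun n => ?_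
  rw [mem_S]
  simp only [Nat.succ_eq_add_one, id]
  refine and_congr Iff.rfl (forall₂_congr fun e _ => by tauto)

theorem comp_e0 : Computable e0 := by
  obtain ⟨i1, i2, h⟩ := ofNat_eq
  have hex : ∀ x : ℕ, ∃ m, x + m + 1 ∈ Set.range e0 := by
    intro x
    obtain ⟨b, hb, hx⟩ := (Set.infinite_coe_iff.1 i2).exists_gt x
    exact ⟨b - x - 1, by rwa [show x + (b - x - 1) + 1 = b by omega]⟩
  have hf : Computable (fun x => Nat.find (hex x)) := by
    apply Computable.find (P := fun x m => x + m + 1 ∈ Set.range e0)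
    exact (primS.comp (Primrec.succ.comp (Primrec.nat_add.comp Primrec.fst Primrec.snd))).computablePred
  have hg : Computable (fun n => (Nat.Subtype.ofNat (Set.range e0) n).val) := by
    have hs : Computable₂ (fun (_ : ℕ) (y : ℕ × ℕ) => y.2 + Nat.find (hex y.2) + 1) := by
      have y2 : Computable (fun p : ℕ × (ℕ × ℕ) => p.2.2) := Computable.snd.comp Computable.snd
      exact Computable.succ.comp (Primrec.nat_add.to_comp.comp y2 (hf.comp y2))
    refine (Computable.nat_rec Computable.id (Computable.const (⊥ : Set.range e0).val) hs).of_eq fun n => ?_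
    induction n with
    | zero => rfl
    | succ n ih =>
      rw [Nat.Subtype.ofNat, Nat.Subtype.succ]
      simp only [id] at ih ⊢
      simp only [← ih]
  refine (hg.comp Computable.encode).of_eq fun q => ?_
  rw [← h, Denumerable.ofNat_encode]

theorem comp_num : Computable (fun q : ℚ => q.num.toNat) := by
  have h : Computable (fun q : ℚ => (e0 q).unpair.1) := Computable.fst.comp (Computable.unpair.comp comp_e0)
  have h2 : Primrec (fun n : ℕ => if n % 2 = 0 then n / 2 else 0) :=
    Primrec.ite (Primrec.eq.comp (Primrec.nat_mod.comp Primrec.id (Primrec.const 2)) (Primrec.const 0))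
      (Primrec.nat_div.comp Primrec.id (Primrec.const 2)) (Primrec.const 0)
  refine (h2.to_comp.comp h).of_eq fun q => ?_
  rw [toNat_eq, e0_eq, Nat.unpair_pair]
theorem comp_den : Computable (fun q : ℚ => q.den) := by
  refine (Computable.snd.comp (Computable.unpair.comp comp_e0)).of_eq fun q => ?_
  rw [e0_eq, Nat.unpair_pair]

theorem pf_unique {S : Set (List Bool)} (h : PrefixFreeSet S) (h0 : [] ∉ S) :
    InformationTheory.UniquelyDecodable S := by
  intro L₁
  induction L₁ with
  | nil =>
    intro L₂ _ h2 he
    cases L₂ with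
    | nil => rfl
    | cons w L =>
      simp at he
      exact absurd (he.1 ▸ h2 w (by simp)) h0
  | cons v L ih =>
    intro L₂ h1 h2 he
    cases L₂ with
    | nil =>
      simp at he
      exact absurd (he.1 ▸ h1 v (by simp)) h0
    | cons w L' =>
      have hv := h1 v (by simp)
      have hw := h2 w (by simp)
      simp only [List.flatten_cons] at he
      have hvw : v = w := by
        rcases List.prefix_or_prefix_of_prefix (List.prefix_append v L.flatten)
          (he ▸ List.prefix_append w L'.flatten) with h3 | h3
        · exact h _ hv _ hw h3
        · exact (h _ hw _ hv h3).symm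
      subst hvw
      rw [ih L' (fun w hw => h1 w (by simp [hw])) (fun w hw => h2 w (by simp [hw]))
        (List.append_cancel_left he)]

theorem pf_summable {S : Set (List Bool)} (h : PrefixFreeSet S) :
    Summable (fun p : S => (2 : ℝ) ^ (-(p.val.length : ℤ))) := by
  by_cases h0 : [] ∈ S
  · have : Subsingleton S := ⟨fun a b => Subtype.ext
      ((h _ h0 _ a.2 List.nil_prefix).symm.trans (h _ h0 _ b.2 List.nil_prefix))⟩
    exact Summable.of_finite
  · refine summable_of_sum_le (c := 1) (fun _ => by positivity) fun u => ?_
    have hu : InformationTheory.UniquelyDecodable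
        ((u.map (Function.Embedding.subtype _) : Finset (List Bool)) : Set (List Bool)) := by
      apply pf_unique
      · intro p hp q hq
        simp at hp hq
        exact h p hp.1 q hq.1
      · simp [h0]
    have := InformationTheory.kraft_mcmillan_inequality hu
    rw [Finset.sum_map] at this
    simpa using this

theorem replicate_primrec : Primrec (fun n : ℕ => List.replicate n true ++ [false]) := by
  refine (Primrec.list_append.comp (Primrec.list_map Primrec.list_range
    (Primrec.const true).to₂) (Primrec.const [false])).of_eq fun n => ?_
  simp

def haltMachine : PrefixFreeMachine where
  U p := bif decide (p = List.replicate (p.length - 1) true ++ [false]) then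
    ((Code.eval (Denumerable.ofNat Code (p.length - 1)) 0).map (fun _ => ())) else Part.none
  partrec := by
    have hl : Primrec (fun p : List Bool => p.length - 1) :=
      Primrec.nat_sub.comp Primrec.list_length (Primrec.const 1)
    refine Partrec.cond ?_ ?_ Partrec.none
    · exact (Primrec.eq.comp Primrec.id (replicate_primrec.comp hl)).decide.to_comp
    · refine Partrec.map ?_ (Computable.const ()).to₂
      exact Code.eval_part.comp ((Primrec.ofNat Code).comp hl).to_comp (Computable.const 0)
  prefixFree := by
    have key : ∀ a b : ℕ, (List.replicate a true ++ [false]) <+: (List.replicate b true ++ [false])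
        → a = b := by
      intro a
      induction a with
      | zero =>
        intro b h
        cases b with
        | zero => rfl
        | succ b => simp [List.replicate_succ] at h
      | succ a ih =>
        intro b h
        cases b with
        | zero => simp [List.replicate_succ] at h
        | succ b =>
          simp only [List.replicate_succ, List.cons_append, List.cons_prefix_cons] at h
          rw [ih b h.2]
    intro p hp q hq hpq
    have aux : ∀ p : List Bool, (bif decide (p = List.replicate (p.length - 1) true ++ [false]) then
      ((Code.eval (Denumerable.ofNat Code (p.length - 1)) 0).map (fun _ => ())) else Part.none).Dom →
      p = List.replicate (p.length - 1) true ++ [false] := by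
      intro p hp
      by_contra hne
      simp only [hne, decide_false, cond_false] at hp
      exact hp
    have h1 := aux p hp
    have h2 := aux q hq
    rw [h1, h2] at hpq
    rw [h1, h2, key _ _ hpq]

theorem haltMachine_dom (c : Code) :
    (haltMachine.U (List.replicate (encode c) true ++ [false])).Dom ↔ (Code.eval c 0).Dom := by
  simp [haltMachine]

theorem not_re (M : PrefixFreeMachine) (hU : M.Universal) :
    ¬ REPred (fun p : List Bool => ¬ (M.U p).Dom) := by
  intro h
  obtain ⟨c, hc⟩ := hU haltMachine
  apply ComputablePred.halting_problem_not_re 0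
  have hg : Computable (fun d : Code => c ++ (List.replicate (encode d) true ++ [false])) :=
    (Primrec.list_append.comp (Primrec.const c) (replicate_primrec.comp Primrec.encode)).to_comp
  have := Partrec.comp h hg
  refine REPred.of_eq (p := fun d : Code =>
    ¬ (M.U (c ++ (List.replicate (encode d) true ++ [false]))).Dom) this fun d => ?_
  rw [hc, haltMachine_dom]

theorem exists_re {α : Type} [Primcodable α] {R : α → ℕ → Prop}
    (h : ComputablePred (fun x : α × ℕ => R x.1 x.2)) : REPred (fun a => ∃ t, R a t) := by
  classical
  have h1 : Partrec (fun x : α => Nat.rfind fun n => Part.some (decide (R x n))) :=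
    Partrec.rfind h.decide.partrec
  refine h1.dom_re.of_eq fun a => ?_
  refine Nat.rfind_dom.trans ?_
  simp

open Classical in
noncomputable def wgt (c : Code) (n : ℕ) : ℝ :=
  if n ∈ Set.range (encode : List Bool → ℕ) ∧ (c.eval n).Dom then
    (2 : ℝ) ^ (-((((decode n : Option (List Bool)).getD []).length : ℕ) : ℤ)) else 0

open Classical in
noncomputable def wsum (c : Code) (t : ℕ) : ℕ :=
  Nat.rec 0 (fun n IH => IH +
    if n ∈ Set.range (encode : List Bool → ℕ) ∧ (Code.evaln t c n).isSome then
      2 ^ (t - ((decode n : Option (List Bool)).getD []).length) else 0) t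

theorem pow_prim : Primrec (fun n : ℕ => 2 ^ n) := by
  refine (Primrec.nat_rec₁ 1 (Primrec.nat_mul.comp Primrec.snd (Primrec.const 2)).to₂).of_eq fun n => ?_
  induction n with
  | zero => rfl
  | succ n ih => rw [pow_succ, ← ih]

theorem wsum_prim (c : Code) : Primrec (wsum c) := by
  classical
  have hn : Primrec (fun x : ℕ × (ℕ × ℕ) => x.2.1) := Primrec.fst.comp Primrec.snd
  refine Primrec.nat_rec' Primrec.id (Primrec.const 0) (h := fun t x => x.2 +
    if x.1 ∈ Set.range (encode : List Bool → ℕ) ∧ (Code.evaln t c x.1).isSome then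
      2 ^ (t - ((decode x.1 : Option (List Bool)).getD []).length) else 0) ?_
  refine Primrec.nat_add.comp (Primrec.snd.comp Primrec.snd) (Primrec.ite (PrimrecPred.and ?_ ?_) ?_
    (Primrec.const 0))
  · exact Primcodable.mem_range_encode.comp hn
  · exact Primrec.eq.comp (Primrec.option_isSome.comp (Code.primrec_evaln.comp
      ((Primrec.fst.pair (Primrec.const c)).pair hn))) (Primrec.const true)
  · exact pow_prim.comp (Primrec.nat_sub.comp Primrec.fst (Primrec.list_length.comp
      (Primrec.option_getD.comp (Primrec.decode.comp hn) (Primrec.const []))))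

theorem evaln_isSome_dom {t c n} (h : (Code.evaln t c n).isSome) : (c.eval n).Dom := by
  obtain ⟨x, hx⟩ := Option.isSome_iff_exists.1 h
  exact Part.dom_iff_mem.2 ⟨x, Code.evaln_sound hx⟩

open Classical in
noncomputable def stageSet (c : Code) (t : ℕ) : Finset ℕ :=
  (Finset.range t).filter fun n => (Code.evaln t c n).isSome

theorem wsum_eq (c : Code) (t : ℕ) : (wsum c t : ℝ) = 2 ^ t * ∑ n ∈ stageSet c t, wgt c n := by
  classical
  have h1 : wsum c t = ∑ n ∈ Finset.range t,
    if n ∈ Set.range (encode : List Bool → ℕ) ∧ (Code.evaln t c n).isSome then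
      2 ^ (t - ((decode n : Option (List Bool)).getD []).length) else 0 := by
    unfold wsum
    generalize t = s at *
    have : ∀ u, (Nat.rec 0 (fun n IH => IH +
      if n ∈ Set.range (encode : List Bool → ℕ) ∧ (Code.evaln s c n).isSome then
      2 ^ (s - ((decode n : Option (List Bool)).getD []).length) else 0) u : ℕ) = 
      ∑ n ∈ Finset.range u,
    if n ∈ Set.range (encode : List Bool → ℕ) ∧ (Code.evaln s c n).isSome then
      2 ^ (s - ((decode n : Option (List Bool)).getD []).length) else 0 := by
      intro u
      induction u with
      | zero => rfl
      | succ u ih => rw [Finset.sum_range_succ, ← ih]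
    exact this s
  rw [h1, stageSet, Finset.sum_filter, Finset.mul_sum, Nat.cast_sum]
  refine Finset.sum_congr rfl fun n hn => ?_
  rw [Finset.mem_range] at hn
  by_cases hs : (Code.evaln t c n).isSome
  · by_cases hr : n ∈ Set.range (encode : List Bool → ℕ)
    · rw [if_pos ⟨hr, hs⟩, if_pos hs, wgt, if_pos ⟨hr, evaln_isSome_dom hs⟩]
      obtain ⟨p, rfl⟩ := hr
      have := Encodable.length_le_encode p
      simp only [encodek, Option.getD_some]
      rw [zpow_neg, zpow_natCast, ← div_eq_mul_inv, eq_div_iff (by positivity)]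
      norm_cast
      rw [← pow_add]
      congr 1
      omega
    · rw [if_neg (fun h => hr h.1), if_pos hs, wgt, if_neg (fun h => hr h.1)]; simp
  · rw [if_neg (fun h => hs h.2), if_neg hs]; simp

theorem wgt_nonneg (c n) : 0 ≤ wgt c n := by
  unfold wgt; split_ifs <;> positivity

theorem wgt_encode (c : Code) (p : List Bool) (h : (c.eval (encode p)).Dom) :
    wgt c (encode p) = (2 : ℝ) ^ (-(p.length : ℤ)) := by
  rw [wgt, if_pos ⟨⟨p, rfl⟩, h⟩]; simp

theorem hasSum_wgt (M : PrefixFreeMachine) (c : Code)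
    (hc : ∀ p : List Bool, (c.eval (encode p)).Dom ↔ (M.U p).Dom) :
    HasSum (wgt c) (Omega M) := by
  have hs := (pf_summable M.prefixFree).hasSum
  let i : {p : List Bool // (M.U p).Dom} → ℕ := fun p => encode p.val
  have hi : Function.Injective i := fun a b h => Subtype.ext (encode_injective h)
  rw [← hi.hasSum_iff]
  · have he : wgt c ∘ i = fun p : {p : List Bool // (M.U p).Dom} =>
        (2 : ℝ) ^ (-(p.val.length : ℤ)) := by
      funext p
      exact wgt_encode c p.val ((hc _).2 p.2)
    rw [he]
    exact hs
  · intro n hn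
    rw [wgt, if_neg]
    rintro ⟨⟨p, rfl⟩, hd⟩
    exact hn ⟨⟨p, (hc p).1 hd⟩, rfl⟩

theorem exists_code_dom (M : PrefixFreeMachine) :
    ∃ c : Code, ∀ p : List Bool, (c.eval (encode p)).Dom ↔ (M.U p).Dom := by
  obtain ⟨c, hc⟩ := Code.exists_code.1 M.partrec
  refine ⟨c, fun p => ?_⟩
  rw [hc]
  simp

theorem exists_stage (c : Code) {x O : ℝ} (h : HasSum (wgt c) O) (hx : x < O) :
    ∃ t, x < ∑ n ∈ stageSet c t, wgt c n := by
  obtain ⟨N, hN⟩ := (h.tendsto_sum_nat.eventually (lt_mem_nhds hx)).exists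
  have hk : ∀ n, ∃ k, wgt c n ≠ 0 → ∀ t ≥ k, (Code.evaln t c n).isSome := by
    intro n
    by_cases hd : (c.eval n).Dom
    · obtain ⟨y, hy⟩ := Part.dom_iff_mem.1 hd
      obtain ⟨k, hk⟩ := Code.evaln_complete.1 hy
      exact ⟨k, fun _ t ht => Option.isSome_iff_exists.2 ⟨y, Code.evaln_mono ht hk⟩⟩
    · exact ⟨0, fun h => absurd (by rw [wgt, if_neg (fun h => hd h.2)]) h⟩
  choose k hk using hk
  refine ⟨N + ∑ n ∈ Finset.range N, k n, hN.trans_le ?_⟩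
  rw [← Finset.sum_filter_ne_zero]
  refine Finset.sum_le_sum_of_subset_of_nonneg (fun n hn' => ?_) (fun n _ _ => wgt_nonneg c n)
  obtain ⟨hn, h0⟩ := Finset.mem_filter.1 hn'
  have h1 := Finset.single_le_sum (f := k) (fun _ _ => Nat.zero_le _) hn
  have h2 := Finset.mem_range.1 hn
  simp only [stageSet, Finset.mem_filter, Finset.mem_range]
  exact ⟨by omega, hk n h0 _ (by omega)⟩

theorem cond_iff (W A d t k : ℕ) (S : ℝ) (q : ℚ) (hA : A = q.num.toNat) (hd : d = q.den)
    (hW : (W : ℝ) = 2 ^ t * S) :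
    A * 2 ^ t * 2 ^ k ≤ W * d * 2 ^ k + 2 * 2 ^ t * d ↔
      max (q : ℝ) 0 - 2 * (2 : ℝ) ^ (-(k : ℤ)) ≤ S := by
  have hdpos : (0 : ℝ) < d := by rw [hd]; exact_mod_cast q.pos
  have hq : max (q : ℝ) 0 = A / d := by
    rw [eq_div_iff hdpos.ne', max_mul_of_nonneg _ _ hdpos.le, zero_mul, hA, hd]
    have : (q : ℝ) * q.den = q.num := by exact_mod_cast Rat.mul_den_eq_num q
    rw [this, ← Int.cast_natCast, Int.toNat_eq_max]
    push_cast
    rfl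
  have h2t : (0 : ℝ) < 2 ^ t := by positivity
  have h2k : (0 : ℝ) < 2 ^ k := by positivity
  rw [hq, zpow_neg, zpow_natCast, ← Nat.cast_le (α := ℝ)]
  push_cast
  rw [hW]
  have e : (A : ℝ) / d - 2 * (2 ^ k)⁻¹ - S =
    ((A : ℝ) * 2 ^ t * 2 ^ k - (2 ^ t * S * d * 2 ^ k + 2 * 2 ^ t * d)) / (2 ^ t * 2 ^ k * d) := by
    field_simp
    ring
  rw [← sub_nonpos, ← sub_nonpos (b := S), e, div_nonpos_iff]
  have : (0 : ℝ) < 2 ^ t * 2 ^ k * d := by positivity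
  constructor
  · intro h; right; exact ⟨h, this.le⟩
  · rintro (⟨_, h⟩ | ⟨h, _⟩)
    · linarith
    · exact h

theorem main_re (M : PrefixFreeMachine) (hO : ComputableReal (Omega M)) :
    REPred (fun p : List Bool => ¬ (M.U p).Dom) := by
  classical
  obtain ⟨f, hf, hfO⟩ := hO
  obtain ⟨c, hc⟩ := exists_code_dom M
  have hsum := hasSum_wgt M c hc
  have hO0 : 0 ≤ Omega M := hsum.nonneg (wgt_nonneg c)
  have hmax : ∀ k, |Omega M - max (f k : ℝ) 0| ≤ (2 : ℝ) ^ (-(k : ℤ)) := by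
    intro k
    refine le_trans ?_ (hfO k)
    rcases le_total (f k : ℝ) 0 with h | h
    · rw [max_eq_right h, abs_of_nonneg (by linarith), abs_of_nonneg (by linarith)]; linarith
    · rw [max_eq_left h]
  let R : List Bool → ℕ → Prop := fun p t =>
    (f (p.length + 2)).num.toNat * 2 ^ t * 2 ^ (p.length + 2) ≤
      wsum c t * (f (p.length + 2)).den * 2 ^ (p.length + 2)
        + 2 * 2 ^ t * (f (p.length + 2)).den ∧ ¬ (Code.evaln t c (encode p)).isSome = true
  have hR : ComputablePred (fun x : List Bool × ℕ => R x.1 x.2) := by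
    have hk : Primrec (fun x : List Bool × ℕ => x.1.length + 2) :=
      Primrec.nat_add.comp (Primrec.list_length.comp Primrec.fst) (Primrec.const 2)
    have hq := hf.comp hk.to_comp
    have hA := comp_num.comp hq
    have hd := comp_den.comp hq
    have h2k := (pow_prim.comp hk).to_comp
    have h2t : Computable (fun x : List Bool × ℕ => 2 ^ x.2) := (pow_prim.comp Primrec.snd).to_comp
    have hW : Computable (fun x : List Bool × ℕ => wsum c x.2) :=
      ((wsum_prim c).comp Primrec.snd).to_comp
    have hmul := Primrec.nat_mul.to_comp
    have hadd := Primrec.nat_add.to_comp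
    have h1 := Primrec.nat_le.decide.to_comp.comp (hmul.comp (hmul.comp hA h2t) h2k)
      (hadd.comp (hmul.comp (hmul.comp hW hd) h2k)
        (hmul.comp (hmul.comp (Computable.const 2) h2t) hd))
    have h2 : Primrec (fun x : List Bool × ℕ => (Code.evaln x.2 c (encode x.1)).isSome) :=
      Primrec.option_isSome.comp (Code.primrec_evaln.comp
      ((Primrec.snd.pair (Primrec.const c)).pair (Primrec.encode.comp Primrec.fst)))
    have h3 := Primrec.and.to_comp.comp h1 (Primrec.not.comp h2).to_comp
    refine ⟨inferInstance, h3.of_eq fun x => ?_⟩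
    rw [Bool.eq_iff_iff, decide_eq_true_iff, Bool.and_eq_true, decide_eq_true_iff,
      Bool.not_eq_true', ← Bool.not_eq_true]
  refine (exists_re hR).of_eq fun p => ?_
  have hp := hmax (p.length + 2)
  rw [abs_le] at hp
  have hpow : (2 : ℝ) ^ (-(p.length : ℤ)) = 4 * (2 : ℝ) ^ (-((p.length + 2 : ℕ) : ℤ)) := by
    push_cast
    rw [neg_add, zpow_add₀ (by norm_num)]
    norm_num
    ring
  have hpos : (0 : ℝ) < (2 : ℝ) ^ (-((p.length + 2 : ℕ) : ℤ)) := by positivity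
  constructor
  · rintro ⟨t, h1, h2⟩ hd
    rw [cond_iff _ _ _ _ _ _ _ rfl rfl (wsum_eq c t)] at h1
    have hni : encode p ∉ stageSet c t := fun hm => h2 (Finset.mem_filter.1 hm).2
    have h3 := sum_le_hasSum (insert (encode p) (stageSet c t)) (fun n _ => wgt_nonneg c n) hsum
    rw [Finset.sum_insert hni, wgt_encode c p ((hc p).2 hd), hpow] at h3
    linarith [hp.1, hp.2]
  · intro hd
    obtain ⟨t, ht⟩ := exists_stage c hsum
      (x := max (f (p.length + 2) : ℝ) 0 - 2 * (2 : ℝ) ^ (-((p.length + 2 : ℕ) : ℤ)))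
      (by linarith [hp.1, hp.2])
    refine ⟨t, (cond_iff _ _ _ _ _ _ _ rfl rfl (wsum_eq c t)).2 ht.le, fun h => hd ?_⟩
    exact (hc p).1 (evaln_isSome_dom h)

theorem omega_not_computable (M : PrefixFreeMachine) (hU : M.Universal) :
    ¬ ComputableReal (Omega M) := fun h => not_re M hU (main_re M h)
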